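/- arXiv:1308.5201 — 7 statements merged into one kernel-verified Lean document; each statement's English description precedes it below -/
import Mathlib

section
/- Let N ≥ 1, let J⁰ be a complex N×N matrix with J⁰·J⁰ = J⁰ (idempotent), let β₁ ∈ (0,1), β = arctanh(β₁)/β₁, and 0 ≤ C₀ ≤ 1. Define the matrix A = C₀ β (1 − β₁²) J⁰ − I, where I is the N×N identity matrix. Then every element μ of the spectrum of A over ℂ satisfies Re(μ) < 0. -/
/-- The inverse hyperbolic tangent. -/
noncomputable def arctanh (x : ℝ) : ℝ := Real.log ((1 + x) / (1 - x)) / 2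

theorem arctanh_mul_one_sub_sq_lt {x : ℝ} (hx : x ∈ Set.Ioo (0 : ℝ) 1) :
    arctanh x * (1 - x ^ 2) < x := by
  have hx' : x ∈ Set.Ioo (-1 : ℝ) 1 := ⟨by linarith [hx.1], hx.2⟩
  have h_eq : arctanh x = Real.artanh x := by
    rw [Real.artanh_eq_half_log (Set.Ioo_subset_Icc_self hx'), arctanh]
    ring
  have hpos : 0 < 1 - x ^ 2 := by nlinarith [hx.1, hx.2]
  have ht : 0 < Real.artanh x := Real.artanh_pos hx
  have hprod : Real.sinh (Real.artanh x) * Real.cosh (Real.artanh x) = x / (1 - x ^ 2) := by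
    rw [Real.sinh_artanh hx', Real.cosh_artanh hx', div_mul_div_comm, mul_one,
      Real.mul_self_sqrt hpos.le]
  rw [h_eq, ← lt_div_iff₀ hpos, ← hprod]
  nlinarith [Real.self_lt_sinh_iff.2 ht, Real.one_le_cosh (Real.artanh x)]

theorem IsIdempotentElem.spectrum_smul_sub_one_subset {𝕜 R : Type*} [Field 𝕜] [Ring R]
    [Algebra 𝕜 R] {p : R} (hp : IsIdempotentElem p) (c : 𝕜) :
    spectrum 𝕜 (c • p - 1) ⊆ {-1, c - 1} := by
  intro μ hμ
  by_contra hne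
  simp only [Set.mem_insert_iff, Set.mem_singleton_iff, not_or] at hne
  have h₁ : μ + 1 ≠ 0 := fun h => hne.1 (eq_neg_of_add_eq_zero_left h)
  have h₂ : μ + 1 - c ≠ 0 := fun h => hne.2 (by linear_combination h)
  have key : algebraMap 𝕜 R μ - (c • p - 1) = (μ + 1) • (1 - p) + (μ + 1 - c) • p := by
    rw [Algebra.algebraMap_eq_smul_one]
    module
  refine hμ ?_
  rw [spectrum.mem_resolventSet_iff, key, isUnit_iff_exists]
  refine ⟨(μ + 1)⁻¹ • (1 - p) + (μ + 1 - c)⁻¹ • p, ?_, ?_⟩ <;>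
    simp [add_mul, mul_add, hp.eq, hp.one_sub.eq, hp.mul_one_sub_self, hp.one_sub_mul_self,
      smul_smul, h₁, h₂]

/-- if `J⁰` is idempotent, `β₁ ∈ (0,1)`, `β = arctanh(β₁)/β₁` and
`0 ≤ C₀ ≤ 1`, then every spectral value of `A = C₀ β (1 − β₁²) J⁰ − I` has
negative real part. -/
theorem spectrum_of_linearization_neg_re
    (N : ℕ) (hN : 1 ≤ N)
    (J0 : Matrix (Fin N) (Fin N) ℂ) (hJ0 : J0 * J0 = J0)
    (β₁ : ℝ) (hβ₁ : β₁ ∈ Set.Ioo (0 : ℝ) 1)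
    (β : ℝ) (hβ : β = arctanh β₁ / β₁)
    (C₀ : ℝ) (hC₀ : 0 ≤ C₀) (hC₀' : C₀ ≤ 1)
    (A : Matrix (Fin N) (Fin N) ℂ)
    (hA : A = ((C₀ * β * (1 - β₁ ^ 2) : ℝ) : ℂ) • J0 - 1) :
    ∀ μ ∈ spectrum ℂ A, μ.re < 0 := by
  have hc : C₀ * β * (1 - β₁ ^ 2) < 1 := by
    have hb : β * (1 - β₁ ^ 2) < 1 := by
      rw [hβ, div_mul_eq_mul_div, div_lt_one hβ₁.1]
      exact arctanh_mul_one_sub_sq_lt hβ₁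
    rw [mul_assoc]
    rcases le_or_gt (β * (1 - β₁ ^ 2)) 0 with h | h
    · linarith [mul_nonpos_of_nonneg_of_nonpos hC₀ h]
    · linarith [mul_le_of_le_one_left h.le hC₀']
  intro μ hμ
  rw [hA] at hμ
  rcases IsIdempotentElem.spectrum_smul_sub_one_subset (show IsIdempotentElem J0 from hJ0) _ hμ
    with rfl | rfl
  · simp
  · rw [Complex.sub_re, Complex.ofReal_re, Complex.one_re]
    linarith
end

section
/- The function g(x) = arctanh(x)·(1 − x²)/x is strictly decreasing on the open interval (0, 1). -/
theorem hasDerivAt_arctanh {x : ℝ} (hx : x ∈ Set.Ioo (-1) 1) :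
    HasDerivAt arctanh (1 / (1 - x ^ 2)) x := by
  have h₁ : 0 < 1 + x := by linarith [hx.1]
  have h₂ : 0 < 1 - x := by linarith [hx.2]
  have h₃ : 1 - x ^ 2 ≠ 0 := by nlinarith [mul_pos h₁ h₂]
  have h := ((((hasDerivAt_id x).const_add 1).div ((hasDerivAt_id x).const_sub 1)
    h₂.ne').log (div_pos h₁ h₂).ne').div_const 2
  refine h.congr_deriv ?_
  simp only [Pi.div_apply, id_eq]
  field_simp
  ring

theorem le_arctanh {x : ℝ} (hx₀ : 0 ≤ x) (hx₁ : x < 1) : x ≤ arctanh x := by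
  have h := le_hasSum (Real.hasSum_log_sub_log_of_abs_lt_one (abs_lt.2 ⟨by linarith, hx₁⟩)) 0
    fun _ _ => by positivity
  norm_num at h
  rw [arctanh, Real.log_div (by linarith) (by linarith)]
  linarith

/-- `g(x) = arctanh(x)·(1 − x²)/x` is strictly decreasing on `(0,1)`. -/
theorem strictAntiOn_arctanh_mul_one_sub_sq_div :
    StrictAntiOn (fun x : ℝ => arctanh x * (1 - x ^ 2) / x) (Set.Ioo 0 1) := by
  have hderiv : ∀ x ∈ Set.Ioo (0 : ℝ) 1,
      HasDerivAt (fun x : ℝ => arctanh x * (1 - x ^ 2) / x)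
        ((x - arctanh x * (1 + x ^ 2)) / x ^ 2) x := by
    rintro x ⟨hx₀, hx₁⟩
    have hne : 1 - x ^ 2 ≠ 0 := by nlinarith
    have h := ((hasDerivAt_arctanh ⟨by linarith, hx₁⟩).mul
      ((hasDerivAt_pow 2 x).const_sub 1)).div (hasDerivAt_id x) hx₀.ne'
    refine h.congr_deriv ?_
    simp only [Pi.mul_apply, id_eq]
    field_simp
    push_cast
    ring
  refine strictAntiOn_of_deriv_neg (convex_Ioo 0 1)
    (fun x hx => (hderiv x hx).continuousAt.continuousWithinAt) fun x hx => ?_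
  rw [interior_Ioo] at hx
  rw [(hderiv x hx).deriv]
  obtain ⟨hx₀, hx₁⟩ := hx
  have hle := le_arctanh hx₀.le hx₁
  refine div_neg_of_neg_of_pos ?_ (by positivity)
  nlinarith [mul_pos (hx₀.trans_le hle) (pow_pos hx₀ 2)]
end

section
/- Let β₁ ∈ (0,1), β = arctanh(β₁)/β₁, λ > 0, β_K = β/λ, and let C₀ be a real number with C₀β > 1, C₁ = 1 − C₀. Set s = √((C₀β − 1)/(C₀β)) and p = −(1/λ)·arctanh(s). Then λ·(−p + C₀β_K tanh(λp) + C₁β_Kβ₁) = arctanh(s) − √(C₀β(C₀β − 1)) + C₁·arctanh(β₁). In particular, p is a zero of the function u ↦ −u + C₀β_K tanh(λu) + C₁β_Kβ₁ if and only if arctanh(√((C₀β − 1)/(C₀β))) − √(C₀β(C₀β − 1)) + C₁·arctanh(β₁) = 0. -/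
theorem arctanh_eq_artanh {x : ℝ} (hx : x ∈ Set.Icc (-1 : ℝ) 1) : arctanh x = Real.artanh x := by
  rw [Real.artanh_eq_half_log hx, arctanh]
  ring

theorem tanh_arctanh {x : ℝ} (hx : x ∈ Set.Ioo (-1 : ℝ) 1) : Real.tanh (arctanh x) = x := by
  rw [arctanh_eq_artanh (Set.Ioo_subset_Icc_self hx), Real.tanh_artanh hx]

theorem sqrt_mul_sub_one_eq {x : ℝ} (hx : 0 < x) :
    Real.sqrt (x * (x - 1)) = x * Real.sqrt ((x - 1) / x) := by
  have h : x * (x - 1) = x ^ 2 * ((x - 1) / x) := by field_simp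
  rw [h, Real.sqrt_mul (sq_nonneg x), Real.sqrt_sq hx.le]

theorem sqrt_sub_one_div_mem_Ioo {x : ℝ} (hx : 0 < x) :
    Real.sqrt ((x - 1) / x) ∈ Set.Ioo (-1 : ℝ) 1 := by
  refine ⟨by linarith [Real.sqrt_nonneg ((x - 1) / x)], ?_⟩
  rw [Real.sqrt_lt' one_pos, one_pow, div_lt_one hx]
  linarith

/-- the identity behind the saddle-node bifurcation curve
(equation (2.26) of the paper). -/
theorem saddle_node_curve_identity
    (β₁ : ℝ) (hβ₁ : β₁ ∈ Set.Ioo (0 : ℝ) 1)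
    (β : ℝ) (hβ : β = arctanh β₁ / β₁)
    (lam : ℝ) (hlam : 0 < lam)
    (βK : ℝ) (hβK : βK = β / lam)
    (C₀ C₁ : ℝ) (hC₀β : 1 < C₀ * β) (hC₁ : C₁ = 1 - C₀)
    (s : ℝ) (hs : s = Real.sqrt ((C₀ * β - 1) / (C₀ * β)))
    (p : ℝ) (hp : p = -(1 / lam) * arctanh s) :
    lam * (-p + C₀ * βK * Real.tanh (lam * p) + C₁ * βK * β₁)
      = arctanh s - Real.sqrt (C₀ * β * (C₀ * β - 1)) + C₁ * arctanh β₁ ∧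
    ((-p + C₀ * βK * Real.tanh (lam * p) + C₁ * βK * β₁ = 0) ↔
      arctanh (Real.sqrt ((C₀ * β - 1) / (C₀ * β)))
        - Real.sqrt (C₀ * β * (C₀ * β - 1)) + C₁ * arctanh β₁ = 0) := by
  have hpos : 0 < C₀ * β := by linarith
  have hlp : lam * p = -arctanh s := by rw [hp]; field_simp
  have htanh : Real.tanh (lam * p) = -s := by
    rw [hlp, Real.tanh_neg, tanh_arctanh (hs ▸ sqrt_sub_one_div_mem_Ioo hpos)]
  have hK : lam * βK = β := by rw [hβK]; field_simp
  have hββ₁ : β * β₁ = arctanh β₁ := by rw [hβ, div_mul_cancel₀ _ hβ₁.1.ne']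
  have key : lam * (-p + C₀ * βK * Real.tanh (lam * p) + C₁ * βK * β₁)
      = arctanh s - Real.sqrt (C₀ * β * (C₀ * β - 1)) + C₁ * arctanh β₁ := by
    rw [sqrt_mul_sub_one_eq hpos, ← hs, htanh, ← hββ₁]
    linear_combination -hlp + (C₁ * β₁ - C₀ * s) * hK
  refine ⟨key, ?_⟩
  rw [← hs, ← key, mul_eq_zero, or_iff_right hlam.ne']
end

section
/- Let a, C₀, C₁, τ, θ be real numbers with 0 ≤ a < 1, 0 ≤ C₀ ≤ 1, C₁ = 1 − C₀, and τ ≥ 0. Then every complex number σ satisfying σ + 1 − a·C₀ − a·C₁·exp(iθ − στ) = 0 has Re(σ) < 0. -/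
open Complex

/-- if `0 ≤ a < 1`, `0 ≤ C₀ ≤ 1`, `C₁ = 1 − C₀` and `τ ≥ 0`, then
every root `σ` of `σ + 1 − aC₀ − aC₁ e^{iθ − στ} = 0` has negative real part. -/
theorem characteristic_roots_neg_re_of_small_gain
    (a C₀ C₁ τ θ : ℝ)
    (ha0 : 0 ≤ a) (ha1 : a < 1)
    (hC₀ : 0 ≤ C₀) (hC₀' : C₀ ≤ 1) (hC₁ : C₁ = 1 - C₀)
    (hτ : 0 ≤ τ) :
    ∀ σ : ℂ,
      σ + 1 - (a * C₀ : ℝ) - (a * C₁ : ℝ) * Complex.exp ((θ : ℂ) * Complex.I - σ * (τ : ℂ)) = 0 →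
      σ.re < 0 := by
  intro σ hσ
  by_contra! hre
  set z : ℂ := (θ : ℂ) * Complex.I - σ * (τ : ℂ) with hz
  have hz_re : z.re ≤ 0 := by
    have : z.re = -(σ.re * τ) := by simp [hz]
    rw [this]
    exact neg_nonpos.mpr (mul_nonneg hre hτ)
  have hexp : (Complex.exp z).re ≤ 1 := by
    refine (Complex.re_le_norm _).trans ?_
    rw [Complex.norm_exp]
    exact Real.exp_le_one_iff.mpr hz_re
  have hroot := congrArg Complex.re hσ
  rw [Complex.sub_re, Complex.sub_re, Complex.add_re, Complex.re_ofReal_mul, Complex.ofReal_re,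
    Complex.one_re, Complex.zero_re] at hroot
  have hC₁_nonneg : 0 ≤ C₁ := by linarith
  have hbound := mul_le_mul_of_nonneg_left hexp (mul_nonneg ha0 hC₁_nonneg)
  have hsum : a * C₀ + a * C₁ = a := by rw [hC₁]; ring
  linarith
end

section
/- Let τ > 0, β > 1, C₀ ∈ ℝ, and θ, ω ∈ ℝ. If the purely imaginary number σ = iω satisfies the characteristic factor equation iω + τ(1 − C₀β) − τ(1 − C₀)β·exp(iθ − iω) = 0, then C₀ = (β + 1)/(2β) − ω²/(2τ²(β − 1)β). -/
/-- equation (3.10): if `σ = iω` is a purely imaginary root of the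
characteristic factor `σ + τ(1 − C₀β) − τ(1 − C₀)β e^{iθ − σ} = 0`, then
`C₀ = (β+1)/(2β) − ω²/(2τ²(β−1)β)`. -/
theorem C0_formula_of_purely_imaginary_root
    (τ β C₀ θ ω : ℝ) (hτ : 0 < τ) (hβ : 1 < β)
    (h : (ω : ℂ) * Complex.I + (τ * (1 - C₀ * β) : ℝ)
        - (τ * (1 - C₀) * β : ℝ) *
          Complex.exp ((θ : ℂ) * Complex.I - (ω : ℂ) * Complex.I) = 0) :
    C₀ = (β + 1) / (2 * β) - ω ^ 2 / (2 * τ ^ 2 * (β - 1) * β) := by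
  have hnorm := congrArg Complex.normSq (sub_eq_zero.mp h)
  rw [← sub_mul, ← Complex.ofReal_sub, Complex.normSq_mul, Complex.normSq_ofReal,
    Complex.normSq_eq_norm_sq (Complex.exp _), Complex.norm_exp_ofReal_mul_I, add_comm,
    Complex.normSq_add_mul_I] at hnorm
  have hβ₁ : β - 1 ≠ 0 := by linarith
  have hβ₀ : β ≠ 0 := by linarith
  field_simp
  linear_combination hnorm
end

section
/- Let τ > 0, β > 1, 0 ≤ C₀ < 1, and θ ∈ ℝ. Then σ = 0 is a root of the characteristic factor, i.e. τ(1 − C₀β) − τ(1 − C₀)β·exp(iθ) = 0, if and only if cos(θ) = −1 and C₀ = (1 + β)/(2β). -/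
/-- pitchfork curve (3.14): for `τ > 0`, `β > 1`, `0 ≤ C₀ < 1`,
`σ = 0` is a root of the characteristic factor iff `cos θ = −1` and
`C₀ = (1 + β)/(2β)`. -/
theorem zero_characteristic_root_iff
    (τ β C₀ θ : ℝ) (hτ : 0 < τ) (hβ : 1 < β)
    (hC₀ : 0 ≤ C₀) (hC₀' : C₀ < 1) :
    ((τ * (1 - C₀ * β) : ℝ)
        - (τ * (1 - C₀) * β : ℝ) * Complex.exp ((θ : ℂ) * Complex.I) = 0)
      ↔ (Real.cos θ = -1 ∧ C₀ = (1 + β) / (2 * β)) := by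
  have hβ0 : 0 < β := one_pos.trans hβ
  have hcoef : τ * (1 - C₀) * β ≠ 0 := by
    have : 0 < 1 - C₀ := sub_pos.mpr hC₀'
    positivity
  rw [Complex.ext_iff, eq_div_iff (by positivity)]
  simp only [Complex.sub_re, Complex.sub_im, Complex.re_ofReal_mul, Complex.im_ofReal_mul,
    Complex.ofReal_re, Complex.ofReal_im, Complex.exp_ofReal_mul_I_re,
    Complex.exp_ofReal_mul_I_im, Complex.zero_re, Complex.zero_im]
  constructor
  · rintro ⟨hre, him⟩
    have hsin : Real.sin θ = 0 := by
      rw [zero_sub, neg_eq_zero] at him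
      exact (mul_eq_zero.mp him).resolve_left hcoef
    rcases Real.sin_eq_zero_iff_cos_eq.mp hsin with hcos | hcos
    · have : τ * (β - 1) = 0 := by rw [hcos] at hre; linarith
      exact absurd this (mul_pos hτ (sub_pos.mpr hβ)).ne'
    · refine ⟨hcos, mul_left_cancel₀ hτ.ne' ?_⟩
      rw [hcos] at hre
      linarith
  · rintro ⟨hcos, hC⟩
    have hsin : Real.sin θ = 0 := Real.sin_eq_zero_iff_cos_eq.mpr (Or.inr hcos)
    rw [hcos, hsin]
    exact ⟨by linear_combination -τ * hC, by ring⟩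
end

section
/- Let τ > 0, β > 1, 0 ≤ C₀ ≤ 1 and C₁ = 1 − C₀. Then there exists a real number σ > 0 such that σ + τ(1 − C₀β) − τ·C₁·β·exp(−σ) = 0. In particular, the characteristic factor corresponding to the index n_i = 0 always has a real characteristic root with positive real part. -/
/-- for `τ > 0`, `β > 1`, `0 ≤ C₀ ≤ 1`, `C₁ = 1 − C₀`, the
characteristic factor corresponding to the index `n_i = 0` always has a positive
real root: there exists `σ > 0` with `σ + τ(1 − C₀β) − τC₁β e^{−σ} = 0`. -/
theorem positive_real_characteristic_root_for_index_zero
    (τ β C₀ C₁ : ℝ) (hτ : 0 < τ) (hβ : 1 < β)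
    (hC₀ : 0 ≤ C₀) (hC₀' : C₀ ≤ 1) (hC₁ : C₁ = 1 - C₀) :
    ∃ σ : ℝ, 0 < σ ∧ σ + τ * (1 - C₀ * β) - τ * C₁ * β * Real.exp (-σ) = 0 := by
  subst hC₁
  have hτβ : 0 < τ * β := by positivity
  have hcont : ContinuousOn
      (fun σ : ℝ => σ + τ * (1 - C₀ * β) - τ * (1 - C₀) * β * Real.exp (-σ))
      (Set.Icc 0 (τ * β)) := by fun_prop
  have hexp : Real.exp (-(τ * β)) ≤ 1 := Real.exp_le_one_iff.mpr (by linarith)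
  have hcoef : 0 ≤ τ * (1 - C₀) * β :=
    mul_nonneg (mul_nonneg hτ.le (by linarith)) (by linarith)
  obtain ⟨σ, hσ, hroot⟩ := intermediate_value_Ioo hτβ.le hcont (show (0 : ℝ) ∈ _ from by
    constructor
    · simp only [neg_zero, Real.exp_zero]
      nlinarith [mul_pos hτ (sub_pos.mpr hβ)]
    · have := mul_le_mul_of_nonneg_left hexp hcoef
      nlinarith)
  exact ⟨σ, hσ.1, hroot⟩
end
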